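/- Let M be a TRO in B(H) and let m ∈ B(H) be associated to M, with polar decomposition m = u|m| where |m| = (m*m)^{1/2}. Then the partial isometry u is also associated to M. -/

import Mathlib

noncomputable section
set_option synthInstance.maxHeartbeats 1000000

variable {H : Type*} [NormedAddCommGroup H] [InnerProductSpace ℂ H] [CompleteSpace H]

/-- Closed linear span of a set of bounded operators. -/
def clspan (A : Set (H →L[ℂ] H)) : Set (H →L[ℂ] H) :=
  closure (Submodule.span ℂ A : Set (H →L[ℂ] H))

/-- Set of all products `a * b` with `a ∈ A`, `b ∈ B`. -/
def pmul (A B : Set (H →L[ℂ] H)) : Set (H →L[ℂ] H) := Set.image2 (· * ·) A B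

/-- The set of adjoints of elements of `A`. -/
def sstar (A : Set (H →L[ℂ] H)) : Set (H →L[ℂ] H) := star '' A

/-- `M` is a ternary ring of operators: a norm-closed linear subspace with `M M* M ⊆ M`. -/
structure IsTRO (M : Set (H →L[ℂ] H)) : Prop where
  isClosed : IsClosed M
  zero_mem : (0 : H →L[ℂ] H) ∈ M
  add_mem : ∀ x ∈ M, ∀ y ∈ M, x + y ∈ M
  smul_mem : ∀ (c : ℂ), ∀ x ∈ M, c • x ∈ M
  mul_mem : ∀ x ∈ M, ∀ y ∈ M, ∀ z ∈ M, x * star y * z ∈ M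

/-- `u` is associated to the TRO `M`:  `cl-span(M* u) = cl-span(M* M)` and
`cl-span(u M*) = cl-span(M M*)`. -/
def AssociatedTo (u : H →L[ℂ] H) (M : Set (H →L[ℂ] H)) : Prop :=
  clspan (pmul (sstar M) {u}) = clspan (pmul (sstar M) M) ∧
  clspan (pmul {u} (sstar M)) = clspan (pmul M (sstar M))

open Filter Topology

/-- Closed span as a submodule. -/
def cls (A : Set (H →L[ℂ] H)) : Submodule ℂ (H →L[ℂ] H) :=
  (Submodule.span ℂ A).topologicalClosure

lemma clspan_eq (A : Set (H →L[ℂ] H)) : clspan A = (cls A : Set (H →L[ℂ] H)) := rfl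

lemma cls_closed (A : Set (H →L[ℂ] H)) : IsClosed (cls A : Set (H →L[ℂ] H)) :=
  Submodule.isClosed_topologicalClosure _

lemma subset_cls {A : Set (H →L[ℂ] H)} {x : H →L[ℂ] H} (hx : x ∈ A) : x ∈ cls A :=
  Submodule.le_topologicalClosure _ (Submodule.subset_span hx)

lemma cls_ind {S : Set (H →L[ℂ] H)} {K : Submodule ℂ (H →L[ℂ] H)}
    (hK : IsClosed (K : Set (H →L[ℂ] H))) (f : (H →L[ℂ] H) →L[ℂ] (H →L[ℂ] H))
    (h : ∀ s ∈ S, f s ∈ K) {x : H →L[ℂ] H} (hx : x ∈ cls S) : f x ∈ K := by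
  have : cls S ≤ K.comap (f : (H →L[ℂ] H) →ₗ[ℂ] (H →L[ℂ] H)) := by
    apply Submodule.topologicalClosure_minimal
    · exact Submodule.span_le.2 h
    · exact hK.preimage f.continuous
  exact this hx

lemma cls_le {S : Set (H →L[ℂ] H)} {K : Submodule ℂ (H →L[ℂ] H)}
    (hK : IsClosed (K : Set (H →L[ℂ] H)))
    (h : ∀ s ∈ S, s ∈ K) {x : H →L[ℂ] H} (hx : x ∈ cls S) : x ∈ K :=
  cls_ind hK (ContinuousLinearMap.id ℂ _) h hx

lemma cls_left {S : Set (H →L[ℂ] H)} {K : Submodule ℂ (H →L[ℂ] H)}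
    (hK : IsClosed (K : Set (H →L[ℂ] H))) (a : H →L[ℂ] H)
    (h : ∀ s ∈ S, a * s ∈ K) {x : H →L[ℂ] H} (hx : x ∈ cls S) : a * x ∈ K :=
  cls_ind hK (ContinuousLinearMap.mul ℂ (H →L[ℂ] H) a) h hx

lemma cls_right {S : Set (H →L[ℂ] H)} {K : Submodule ℂ (H →L[ℂ] H)}
    (hK : IsClosed (K : Set (H →L[ℂ] H))) (a : H →L[ℂ] H)
    (h : ∀ s ∈ S, s * a ∈ K) {x : H →L[ℂ] H} (hx : x ∈ cls S) : x * a ∈ K :=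
  cls_ind hK ((ContinuousLinearMap.mul ℂ (H →L[ℂ] H)).flip a) h hx

lemma cls_star {S : Set (H →L[ℂ] H)} {x : H →L[ℂ] H} (hx : x ∈ cls S) :
    star x ∈ cls (sstar S) := by
  let K : Submodule ℂ (H →L[ℂ] H) :=
    { carrier := {y | star y ∈ cls (sstar S)}
      add_mem' := by
        intro a b ha hb
        simp only [Set.mem_ofPred_eq, star_add] at *
        exact add_mem ha hb
      zero_mem' := by simp
      smul_mem' := by
        intro c a ha
        simp only [Set.mem_ofPred_eq, star_smul] at *
        exact Submodule.smul_mem _ _ ha }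
  have hK : IsClosed (K : Set (H →L[ℂ] H)) :=
    (cls_closed (sstar S)).preimage continuous_star
  exact cls_le (K := K) hK (fun s hs => subset_cls ⟨s, hs, rfl⟩) hx

lemma sstar_sstar (S : Set (H →L[ℂ] H)) : sstar (sstar S) = S := by
  ext x; simp [sstar]

lemma sstar_pmul (S T : Set (H →L[ℂ] H)) : sstar (pmul S T) = pmul (sstar T) (sstar S) := by
  ext x
  simp only [sstar, pmul, Set.mem_image, Set.mem_image2]
  constructor
  · rintro ⟨_, ⟨a, ha, b, hb, rfl⟩, rfl⟩
    exact ⟨_, ⟨b, hb, rfl⟩, _, ⟨a, ha, rfl⟩, by simp⟩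
  · rintro ⟨_, ⟨b, hb, rfl⟩, _, ⟨a, ha, rfl⟩, rfl⟩
    exact ⟨_, ⟨a, ha, b, hb, rfl⟩, by simp⟩

lemma sstar_singleton (u : H →L[ℂ] H) : sstar {u} = {star u} := by simp [sstar]

lemma sstar_clspan (S : Set (H →L[ℂ] H)) : sstar (clspan S) = clspan (sstar S) := by
  ext x
  constructor
  · rintro ⟨y, hy, rfl⟩
    exact cls_star hy
  · intro hx
    refine ⟨star x, ?_, star_star x⟩
    have := cls_star (S := sstar S) hx
    rwa [sstar_sstar] at this

/-- A TRO as a submodule. -/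
def IsTRO.sub {M : Set (H →L[ℂ] H)} (hM : IsTRO M) : Submodule ℂ (H →L[ℂ] H) where
  carrier := M
  add_mem' := fun {a b} ha hb => hM.add_mem a ha b hb
  zero_mem' := hM.zero_mem
  smul_mem' := fun c a ha => hM.smul_mem c a ha

lemma IsTRO.sstar {M : Set (H →L[ℂ] H)} (hM : IsTRO M) : IsTRO (sstar M) where
  isClosed := by
    have : _root_.sstar M = star ⁻¹' M := by
      ext x
      constructor
      · rintro ⟨y, hy, rfl⟩; simpa using hy
      · intro hx; exact ⟨star x, hx, star_star x⟩
    rw [this]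
    exact hM.isClosed.preimage continuous_star
  zero_mem := ⟨0, hM.zero_mem, by simp⟩
  add_mem := by
    rintro _ ⟨x, hx, rfl⟩ _ ⟨y, hy, rfl⟩
    exact ⟨x + y, hM.add_mem x hx y hy, by simp⟩
  smul_mem := by
    rintro c _ ⟨x, hx, rfl⟩
    exact ⟨star c • x, hM.smul_mem _ x hx, by rw [star_smul, star_star]⟩
  mul_mem := by
    rintro _ ⟨x, hx, rfl⟩ _ ⟨y, hy, rfl⟩ _ ⟨z, hz, rfl⟩
    exact ⟨z * star y * x, hM.mul_mem z hz y hy x hx, by simp [mul_assoc]⟩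

lemma real_bound (s : ℝ) (h0 : 0 ≤ s) (h1 : s ≤ 1) (k : ℕ) :
    (k : ℝ) * (s * (1 - s) ^ k) ≤ 1 := by
  have hB : 1 + (k : ℝ) * s ≤ (1 + s) ^ k := one_add_mul_le_pow (by linarith) k
  have hp : 0 ≤ (1 - s) ^ k := pow_nonneg (by linarith) k
  have h2 : (1 + s) ^ k * (1 - s) ^ k ≤ 1 := by
    rw [← mul_pow]
    apply pow_le_one₀ <;> nlinarith
  nlinarith [mul_le_mul_of_nonneg_right hB hp]

lemma norm_bound (x : H →L[ℂ] H) (c : ℝ) (hc : 0 < c) (hcx : ‖star x * x‖ ≤ c) (n : ℕ) :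
    (n : ℝ) * ‖x * (1 - (c⁻¹ : ℝ) • (star x * x)) ^ n‖ ^ 2 ≤ c := by
  rcases Nat.eq_zero_or_pos n with rfl | hn
  · simpa using hc.le
  have hn' : (0 : ℝ) < n := by exact_mod_cast hn
  set a := star x * x with ha
  have hasa : IsSelfAdjoint a := IsSelfAdjoint.star_mul_self x
  have hapos : 0 ≤ a := star_mul_self_nonneg x
  have hb : (1 - (c⁻¹ : ℝ) • a) ^ n = cfc (fun t : ℝ => (1 - c⁻¹ * t) ^ n) a := by
    rw [cfc_pow (fun t : ℝ => 1 - c⁻¹ * t) n a, cfc_sub (fun _ : ℝ => (1 : ℝ)) (fun t => c⁻¹ * t) a,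
      cfc_const_one ℝ a, cfc_const_mul_id c⁻¹ a]
  have hsa : star ((1 - (c⁻¹ : ℝ) • a) ^ n) = (1 - (c⁻¹ : ℝ) • a) ^ n := by
    rw [hb]; exact cfc_predicate (R := ℝ) (p := IsSelfAdjoint) _ a
  have hnorm : ‖x * (1 - (c⁻¹ : ℝ) • a) ^ n‖ ^ 2 ≤ c / n := by
    rw [sq, ← CStarRing.norm_star_mul_self, star_mul, hsa]
    have : (1 - (c⁻¹ : ℝ) • a) ^ n * star x * (x * (1 - (c⁻¹ : ℝ) • a) ^ n)
        = cfc (fun t : ℝ => (1 - c⁻¹ * t) ^ n * t * (1 - c⁻¹ * t) ^ n) a := by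
      rw [cfc_mul (fun t : ℝ => (1 - c⁻¹ * t) ^ n * t) (fun t => (1 - c⁻¹ * t) ^ n) a,
        cfc_mul (fun t : ℝ => (1 - c⁻¹ * t) ^ n) (fun t => t) a, ← hb, cfc_id' ℝ a, ha]
      simp only [mul_assoc]
    rw [this]
    apply norm_cfc_le (by positivity)
    intro t ht
    have ht0 : 0 ≤ t := spectrum_nonneg_of_nonneg hapos ht
    have ht1 : t ≤ c := by
      have := norm_apply_le_norm_cfc (fun t : ℝ => t) a ht
      rw [cfc_id' ℝ a] at this
      exact (le_abs_self t).trans (this.trans hcx)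
    have hs0 : 0 ≤ c⁻¹ * t := by positivity
    have hs1 : c⁻¹ * t ≤ 1 := by rw [inv_mul_le_iff₀ hc]; simpa using ht1
    have hq : 0 ≤ (1 - c⁻¹ * t) ^ n := pow_nonneg (by linarith) n
    have hq1 : (1 - c⁻¹ * t) ^ n ≤ 1 := pow_le_one₀ (by linarith) (by linarith)
    rw [Real.norm_of_nonneg (by positivity)]
    have hr := real_bound _ hs0 hs1 n
    have hr' : t * (1 - c⁻¹ * t) ^ n ≤ c / n := by
      rw [le_div_iff₀ hn']
      have : (n : ℝ) * (c⁻¹ * t * (1 - c⁻¹ * t) ^ n) = c⁻¹ * (t * (1 - c⁻¹ * t) ^ n * n) := by ring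
      rw [this, inv_mul_le_iff₀ hc] at hr
      simpa using hr
    have : 0 ≤ t * (1 - c⁻¹ * t) ^ n := by positivity
    nlinarith
  rw [le_div_iff₀ hn'] at hnorm
  linarith

lemma tro_cube {M : Set (H →L[ℂ] H)} (hM : IsTRO M) {x : H →L[ℂ] H} (hx : x ∈ M) :
    x ∈ cls (pmul (pmul M (sstar M)) M) := by
  set c : ℝ := ‖star x * x‖ + 1 with hc
  have hc0 : 0 < c := by positivity
  set b : H →L[ℂ] H := 1 - (c⁻¹ : ℝ) • (star x * x) with hb
  have step : ∀ y, y * b = y - ((c⁻¹ : ℝ) : ℂ) • (y * star x * x) := by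
    intro y
    rw [hb, mul_sub, mul_one, mul_smul_comm, mul_assoc, Complex.coe_smul]
  have h1 : ∀ n : ℕ, x * b ^ n ∈ M := by
    intro n
    induction n with
    | zero => simpa using hx
    | succ k ih =>
      rw [pow_succ, ← mul_assoc, step]
      exact hM.sub.sub_mem ih (hM.smul_mem _ _ (hM.mul_mem _ ih _ hx _ hx))
  have h2 : ∀ n : ℕ, x - x * b ^ n ∈ cls (pmul (pmul M (sstar M)) M) := by
    intro n
    induction n with
    | zero => simp
    | succ k ih =>
      rw [pow_succ, ← mul_assoc, step, sub_sub_eq_add_sub, add_sub_right_comm]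
      refine add_mem ih (Submodule.smul_mem _ _ (subset_cls ?_))
      exact ⟨_, ⟨_, h1 k, _, ⟨x, hx, rfl⟩, rfl⟩, x, hx, rfl⟩
  have h3 : Tendsto (fun n : ℕ => x * b ^ n) atTop (𝓝 0) := by
    rw [tendsto_zero_iff_norm_tendsto_zero]
    have h4 : Tendsto (fun n : ℕ => ‖x * b ^ n‖ ^ 2) atTop (𝓝 0) := by
      refine squeeze_zero' (Eventually.of_forall fun n => by positivity) ?_
        (tendsto_const_div_atTop_nhds_zero_nat c)
      filter_upwards [eventually_gt_atTop 0] with n hn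
      have hn' : (0 : ℝ) < n := by exact_mod_cast hn
      rw [le_div_iff₀ hn', mul_comm]
      exact norm_bound x c hc0 (by linarith) n
    have h5 := h4.sqrt
    simpa using h5
  have h6 : Tendsto (fun n : ℕ => x - x * b ^ n) atTop (𝓝 (x - 0)) := tendsto_const_nhds.sub h3
  rw [sub_zero] at h6
  exact (cls_closed _).mem_of_tendsto h6 (Eventually.of_forall h2)

/-- operators `t` with `t N ⊆ N`, `t* N ⊆ N`. -/
def stab (N : Submodule ℂ (H →L[ℂ] H)) : NonUnitalStarSubalgebra ℂ (H →L[ℂ] H) where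
  carrier := {t | ∀ z ∈ N, t * z ∈ N ∧ star t * z ∈ N}
  add_mem' := by
    intro a b ha hb z hz
    simp only [star_add, add_mul]
    exact ⟨add_mem (ha z hz).1 (hb z hz).1, add_mem (ha z hz).2 (hb z hz).2⟩
  zero_mem' := by intro z hz; simp
  mul_mem' := by
    intro a b ha hb z hz
    simp only [star_mul, mul_assoc]
    exact ⟨(ha _ (hb z hz).1).1, (hb _ (ha z hz).2).2⟩
  smul_mem' := by
    intro c a ha z hz
    simp only [star_smul, smul_mul_assoc]
    exact ⟨N.smul_mem _ (ha z hz).1, N.smul_mem _ (ha z hz).2⟩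
  star_mem' := by
    intro a ha z hz
    rw [star_star]
    exact (ha z hz).symm

lemma stab_closed (N : Submodule ℂ (H →L[ℂ] H)) (hN : IsClosed (N : Set (H →L[ℂ] H))) :
    IsClosed (stab N : Set (H →L[ℂ] H)) := by
  have : (stab N : Set (H →L[ℂ] H)) =
      ⋂ z ∈ N, ((fun t => t * z) ⁻¹' N ∩ (fun t => star t * z) ⁻¹' N) := by
    ext t
    simp only [Set.mem_iInter, Set.mem_inter_iff, Set.mem_preimage, SetLike.mem_coe]
    rfl
  rw [this]
  refine isClosed_biInter fun z _ => ?_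
  exact (hN.preimage (by fun_prop)).inter (hN.preimage (continuous_star.mul continuous_const))

lemma half {M : Set (H →L[ℂ] H)} (hM : IsTRO M) (m u : H →L[ℂ] H)
    (hm : AssociatedTo m M) (hpolar : m = u * CFC.sqrt (star m * m)) :
    clspan (pmul {u} (sstar M)) = clspan (pmul M (sstar M)) := by
  obtain ⟨hm1, hm2⟩ := hm
  have hm1' : ∀ x, x ∈ cls (pmul (sstar M) {m}) ↔ x ∈ cls (pmul (sstar M) M) :=
    fun x => Set.ext_iff.1 hm1 x
  have hm2' : ∀ x, x ∈ cls (pmul {m} (sstar M)) ↔ x ∈ cls (pmul M (sstar M)) :=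
    fun x => Set.ext_iff.1 hm2 x
  have hm3 : clspan (pmul {star m} M) = clspan (pmul (sstar M) M) := by
    have := congrArg sstar hm1
    rwa [sstar_clspan, sstar_clspan, sstar_pmul, sstar_pmul, sstar_sstar, sstar_singleton] at this
  have hm3' : ∀ x, x ∈ cls (pmul {star m} M) ↔ x ∈ cls (pmul (sstar M) M) :=
    fun x => Set.ext_iff.1 hm3 x
  set p := CFC.sqrt (star m * m) with hp
  have hpp : p * p = star m * m := CFC.sqrt_mul_sqrt_self _ (star_mul_self_nonneg m)
  let N := hM.sstar.sub
  have hN : IsClosed (N : Set (H →L[ℂ] H)) := hM.sstar.isClosed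
  have key : ∀ z ∈ N, star m * m * z ∈ N := by
    intro z hz
    rw [mul_assoc]
    have hmz : m * z ∈ cls (pmul M (sstar M)) := (hm2' _).1 (subset_cls ⟨m, rfl, z, hz, rfl⟩)
    refine cls_left hN _ ?_ hmz
    rintro _ ⟨y, hy, w, hw, rfl⟩
    change star m * (y * w) ∈ N
    rw [← mul_assoc]
    have hmy : star m * y ∈ cls (pmul (sstar M) M) :=
      (hm3' _).1 (subset_cls ⟨star m, rfl, y, hy, rfl⟩)
    refine cls_right hN _ ?_ hmy
    rintro _ ⟨a, ha, b, hb, rfl⟩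
    have := hM.sstar.mul_mem a ha (star b) ⟨b, hb, rfl⟩ w hw
    rwa [star_star] at this
  have hpN : ∀ z ∈ N, p * z ∈ N := by
    have hmem : star m * m ∈ stab N := by
      intro z hz
      rw [star_mul, star_star]
      exact ⟨key z hz, key z hz⟩
    have : p ∈ stab N := by
      rw [hp, CFC.sqrt_eq_real_sqrt _ (star_mul_self_nonneg m)]
      have := stab_closed N hN
      exact cfcₙ_mem (𝕜' := ℂ) _ hmem
    exact fun z hz => (this z hz).1
  have dense : ∀ z ∈ N, z ∈ cls (pmul {p} (sstar M)) := by
    intro z hz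
    refine cls_le (cls_closed _) ?_ (tro_cube hM.sstar hz)
    rintro _ ⟨_, ⟨a, ha, b, hb, rfl⟩, w, hw, rfl⟩
    rw [sstar_sstar] at hb
    have hab : a * b ∈ cls (pmul {star m} M) := (hm3' _).2 (subset_cls ⟨a, ha, b, hb, rfl⟩)
    refine cls_right (cls_closed _) w ?_ hab
    rintro _ ⟨_, rfl, d, hd, rfl⟩
    change star m * d * w ∈ _
    rw [mul_assoc]
    have hdw : d * w ∈ cls (pmul {m} (sstar M)) := (hm2' _).2 (subset_cls ⟨d, hd, w, hw, rfl⟩)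
    refine cls_left (cls_closed _) _ ?_ hdw
    rintro _ ⟨q, hq, e, he, rfl⟩
    rw [Set.mem_singleton_iff.1 hq]
    change star m * (m * e) ∈ _
    rw [← mul_assoc, ← hpp, mul_assoc]
    exact subset_cls ⟨p, rfl, p * e, hpN e he, rfl⟩
  ext x
  rw [clspan_eq, clspan_eq]
  constructor
  · refine cls_le (cls_closed _) ?_
    rintro _ ⟨q, hq, z, hz, rfl⟩
    rw [Set.mem_singleton_iff.1 hq]
    refine cls_left (cls_closed _) _ ?_ (dense z hz)
    rintro _ ⟨q, hq, w, hw, rfl⟩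
    rw [Set.mem_singleton_iff.1 hq]
    change u * (p * w) ∈ _
    rw [← mul_assoc, ← hpolar]
    exact (hm2' _).1 (subset_cls ⟨m, rfl, w, hw, rfl⟩)
  · intro hx
    refine cls_le (cls_closed _) ?_ ((hm2' x).2 hx)
    rintro _ ⟨q, hq, w, hw, rfl⟩
    rw [Set.mem_singleton_iff.1 hq]
    change m * w ∈ _
    rw [hpolar, mul_assoc]
    exact subset_cls ⟨u, rfl, p * w, hpN w hw, rfl⟩

/-- If `m` is associated to the TRO `M` and `m = u * |m|` is its polar decomposition
(with `|m| = (m* m)^{1/2}` and `u` the partial isometry satisfying `u* m = |m|`),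
then `u` is associated to `M`. -/
theorem stmt4 {M : Set (H →L[ℂ] H)} (hM : IsTRO M) (m u : H →L[ℂ] H)
    (hm : AssociatedTo m M)
    (hu_pi : u * star u * u = u)
    (hpolar : m = u * CFC.sqrt (star m * m))
    (hustar_m : star u * m = CFC.sqrt (star m * m)) :
    AssociatedTo u M := by
  refine ⟨?_, half hM m u hm hpolar⟩
  set p := CFC.sqrt (star m * m) with hp
  have hp0 : 0 ≤ p := CFC.sqrt_nonneg _
  have hpsa : star p = p := hp0.isSelfAdjoint
  have hms : star m = p * star u := by
    have := congrArg star hpolar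
    rwa [star_mul, hpsa] at this
  have hups : star u * u * p = p := by
    rw [mul_assoc, ← hpolar, hustar_m]
  have hsq : CFC.sqrt (star (star m) * star m) = u * p * star u := by
    apply CFC.sqrt_unique
    · rw [star_star, hms, ← mul_assoc, ← hpolar]
      calc m * star u * (m * star u) = m * (star u * m) * star u := by simp only [mul_assoc]
        _ = m * p * star u := by rw [hustar_m]
        _ = _ := by rw [mul_assoc]
    · exact star_right_conjugate_nonneg hp0 u
  have hpol' : star m = star u * CFC.sqrt (star (star m) * star m) := by
    rw [hsq, ← mul_assoc, ← mul_assoc, hups, hms]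
  have hm' : AssociatedTo (star m) (sstar M) := by
    obtain ⟨h1, h2⟩ := hm
    constructor
    · have := congrArg sstar h2
      rwa [sstar_clspan, sstar_clspan, sstar_pmul, sstar_pmul, sstar_singleton] at this
    · have := congrArg sstar h1
      rwa [sstar_clspan, sstar_clspan, sstar_pmul, sstar_pmul, sstar_singleton] at this
  have h := congrArg sstar (half hM.sstar (star m) (star u) hm' hpol')
  rwa [sstar_clspan, sstar_clspan, sstar_pmul, sstar_pmul, sstar_singleton, star_star,
    sstar_sstar M] at h
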